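/- Let n ≥ 1 and q > 1. If there exists a positive bounded classical solution of the half-space problem ∂ₜu = Δu in ℝⁿ₊×ℝ, −∂u/∂x₁ = u^q on ∂ℝⁿ₊×ℝ, then there exists a positive classical solution v of the same problem satisfying v(x,t) + |∇v(x,t)| ≤ 1 for all x ∈ closure(ℝⁿ₊) and t ∈ ℝ. -/

import Mathlib

open scoped BigOperators
open Set

/-- The Laplacian of `f : ℝⁿ → ℝ` at `x`, as the sum of the second partial
derivatives in the coordinate directions. -/
noncomputable def lap {n : ℕ} (f : EuclideanSpace ℝ (Fin n) → ℝ)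
    (x : EuclideanSpace ℝ (Fin n)) : ℝ :=
  ∑ i : Fin n,
    fderiv ℝ (fun y => fderiv ℝ f y (EuclideanSpace.single i 1)) x
      (EuclideanSpace.single i 1)

/-- The open half-space `ℝⁿ₊ = {x : x₁ > 0}`. -/
def openHalf (n : ℕ) (hn : 0 < n) : Set (EuclideanSpace ℝ (Fin n)) :=
  {x | 0 < x ⟨0, hn⟩}

/-- The closed half-space `{x : x₁ ≥ 0}` (the closure of `ℝⁿ₊`). -/
def closedHalf (n : ℕ) (hn : 0 < n) : Set (EuclideanSpace ℝ (Fin n)) :=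
  {x | 0 ≤ x ⟨0, hn⟩}

/-- `u` is a positive classical solution of the half-space problem
`∂ₜu = Δu` in `ℝⁿ₊ × ℝ`, `-∂u/∂x₁ = u^q` on `∂ℝⁿ₊ × ℝ`: it is continuous together
with its spatial gradient up to the boundary, `C²` in `x` and `C¹` in `t` in the
open half-space, satisfies the heat equation inside and the nonlinear boundary
condition on the boundary, and is everywhere positive. -/
def IsHalfSpaceSol (n : ℕ) (hn : 0 < n) (q : ℝ)
    (u : EuclideanSpace ℝ (Fin n) × ℝ → ℝ) : Prop :=
  ContinuousOn u (closedHalf n hn ×ˢ (univ : Set ℝ)) ∧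
  (∀ t, ContDiffOn ℝ 1 (fun x => u (x, t)) (closedHalf n hn)) ∧
  (∀ t, ContinuousOn
    (fun x => fderivWithin ℝ (fun y => u (y, t)) (closedHalf n hn) x)
    (closedHalf n hn)) ∧
  (∀ t, ContDiffOn ℝ 2 (fun x => u (x, t)) (openHalf n hn)) ∧
  (∀ x ∈ openHalf n hn, ContDiff ℝ 1 fun s => u (x, s)) ∧
  (∀ x ∈ openHalf n hn, ∀ t : ℝ,
    deriv (fun s => u (x, s)) t = lap (fun y => u (y, t)) x) ∧
  (∀ x : EuclideanSpace ℝ (Fin n), x ⟨0, hn⟩ = 0 → ∀ t : ℝ,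
    -(fderivWithin ℝ (fun y => u (y, t)) (closedHalf n hn) x
        (EuclideanSpace.single ⟨0, hn⟩ 1)) = u (x, t) ^ q) ∧
  (∀ x ∈ closedHalf n hn, ∀ t : ℝ, 0 < u (x, t))

section OneVariable

/-- At a right-endpoint maximum the one-sided derivative is nonpositive. -/
lemma hasDerivWithinAt_Ici_nonpos {f : ℝ → ℝ} {c : ℝ}
    (hf : HasDerivWithinAt f c (Ici 0) 0)
    (hmax : ∀ᶠ s in nhdsWithin 0 (Ioi 0), f s ≤ f 0) : c ≤ 0 := by
  have h := hasDerivWithinAt_iff_tendsto_slope.1 hf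
  rw [Ici_sdiff_left] at h
  refine le_of_tendsto h ?_
  filter_upwards [hmax, self_mem_nhdsWithin] with s hs hs0
  rw [slope_def_field]
  exact div_nonpos_of_nonpos_of_nonneg (by linarith) (by simpa using le_of_lt hs0)

/-- The second derivative is nonpositive at a local maximum. -/
lemma IsLocalMax.second_deriv_nonpos {g g' : ℝ → ℝ} {b : ℝ}
    (h1 : ∀ᶠ s in nhds 0, HasDerivAt g (g' s) s) (h2 : HasDerivAt g' b 0)
    (hmax : IsLocalMax g 0) : b ≤ 0 := by
  by_contra! hb
  have hd : deriv g =ᶠ[nhds 0] g' := h1.mono fun s hs => hs.deriv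
  have hdd : deriv (deriv g) 0 = b := by rw [hd.deriv_eq, h2.deriv]
  have hmin : IsLocalMin g 0 :=
    isLocalMin_of_deriv_deriv_pos (by rw [hdd]; exact hb) hmax.deriv_eq_zero
      h1.self_of_nhds.continuousAt
  have hconst : g =ᶠ[nhds 0] fun _ => g 0 := by
    filter_upwards [hmax, hmin] with s hs1 hs2 using le_antisymm hs1 hs2
  have : deriv (deriv g) 0 = 0 := by
    rw [hconst.deriv.deriv_eq]; simp
  linarith

/-- A concave logarithmic profile solving `φ'' = -a (φ')²`, steep on an interval `(0, r₀]`
on which it climbs to the height `H`. -/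
lemma exists_log_profile (a H : ℝ) (ha : 1 ≤ a) :
    ∃ (φ d : ℝ → ℝ) (r₀ L : ℝ), 0 < r₀ ∧ r₀ ≤ 1 ∧ φ 0 = 0 ∧ H ≤ φ r₀ ∧
      ContinuousOn φ (Ici 0) ∧
      (∀ r, 0 < r → HasDerivAt φ (d r) r) ∧
      (∀ r, 0 < r → HasDerivAt d (-a * d r ^ 2) r) ∧
      (∀ r, 0 < r → r ≤ r₀ → 1 ≤ d r) ∧ (∀ r, 0 ≤ r → φ r ≤ L * r) ∧
      (∀ r, 0 ≤ r → 0 ≤ φ r) := by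
  have ha0 : 0 < a := by linarith
  set r₀ : ℝ := 1 / (2 * a) with hr₀
  have hr₀pos : 0 < r₀ := by positivity
  set ρ : ℝ := r₀ * Real.exp (-(a * |H|)) with hρ
  have hρpos : 0 < ρ := by positivity
  have hρle : ρ ≤ r₀ := by
    have : Real.exp (-(a * |H|)) ≤ 1 := Real.exp_le_one_iff.2 (by simp; positivity)
    nlinarith
  refine ⟨fun r => Real.log (1 + r / ρ) / a, fun r => 1 / (a * (ρ + r)), r₀, 1 / (a * ρ),
    hr₀pos, ?_, by simp, ?_, ?_, ?_, ?_, ?_, ?_, ?_⟩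
  · rw [hr₀, div_le_one (by positivity)]; linarith
  · have h1 : r₀ / ρ = Real.exp (a * |H|) := by
      rw [hρ, Real.exp_neg]; field_simp
    rw [le_div_iff₀ ha0, h1]
    calc H * a ≤ a * |H| := by nlinarith [le_abs_self H]
      _ = Real.log (Real.exp (a * |H|)) := (Real.log_exp _).symm
      _ ≤ _ := Real.log_le_log (Real.exp_pos _) (by linarith)
  · refine ContinuousOn.div_const (ContinuousOn.log (by fun_prop) ?_) _
    intro r hr
    have : 0 ≤ r / ρ := div_nonneg hr hρpos.le
    linarith
  · intro r hr
    have h0 : 1 + r / ρ ≠ 0 := by positivity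
    have h := ((((hasDerivAt_id r).div_const ρ).const_add 1).log h0).div_const a
    refine h.congr_deriv ?_
    simp only [id]
    field_simp
  · intro r hr
    have h0 : a * (ρ + r) ≠ 0 := by positivity
    have h := (((hasDerivAt_id r).const_add ρ).const_mul a).inv h0
    have h' : HasDerivAt (fun r => 1 / (a * (ρ + r))) _ r :=
      h.congr_of_eventuallyEq (Filter.Eventually.of_forall fun s => by simp)
    refine h'.congr_deriv ?_
    simp only [id]
    field_simp
  · intro r hr hrr
    have : a * (ρ + r) ≤ 1 := by
      calc a * (ρ + r) ≤ a * (r₀ + r₀) := by gcongr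
        _ = 1 := by rw [hr₀]; field_simp; norm_num
    rw [le_div_iff₀ (by positivity)]; linarith
  · intro r hr
    have h1 : Real.log (1 + r / ρ) ≤ r / ρ := by
      have := Real.log_le_sub_one_of_pos (show 0 < 1 + r / ρ by positivity)
      linarith
    calc Real.log (1 + r / ρ) / a ≤ (r / ρ) / a := by gcongr
      _ = 1 / (a * ρ) * r := by field_simp
  · intro r hr
    exact div_nonneg (Real.log_nonneg (by have : 0 ≤ r / ρ := by positivity
                                          linarith)) ha0.le

end OneVariable

section SecondDerivative

variable {E : Type*} [NormedAddCommGroup E] [NormedSpace ℝ E]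

lemma hasDerivAt_line (x v : E) (s : ℝ) : HasDerivAt (fun s : ℝ => x + s • v) v s := by
  simpa using ((hasDerivAt_id s).smul_const v).const_add x

lemma ContDiffAt.eventually_hasDerivAt_line {f : E → ℝ} {x : E} (hf : ContDiffAt ℝ 2 f x)
    (v : E) : ∀ᶠ s in nhds (0 : ℝ),
      HasDerivAt (fun s : ℝ => f (x + s • v)) (fderiv ℝ f (x + s • v) v) s := by
  have h1 : ∀ᶠ y in nhds x, DifferentiableAt ℝ f y :=
    (hf.eventually (by simp)).mono fun y hy => hy.differentiableAt (by simp)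
  have h2 : Filter.Tendsto (fun s : ℝ => x + s • v) (nhds 0) (nhds x) := by
    simpa using (hasDerivAt_line x v 0).continuousAt.tendsto
  filter_upwards [h2.eventually h1] with s hs
  exact hs.hasFDerivAt.comp_hasDerivAt s (hasDerivAt_line x v s)

lemma ContDiffAt.hasDerivAt_fderiv_line {f : E → ℝ} {x : E} (hf : ContDiffAt ℝ 2 f x)
    (v : E) : HasDerivAt (fun s : ℝ => fderiv ℝ f (x + s • v) v)
      (fderiv ℝ (fderiv ℝ f) x v v) 0 := by
  have h1 : DifferentiableAt ℝ (fderiv ℝ f) x :=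
    (hf.fderiv_right (m := 1) (by norm_num)).differentiableAt (by simp)
  have h2 : HasDerivAt (fun s : ℝ => fderiv ℝ f (x + s • v))
      (fderiv ℝ (fderiv ℝ f) x v) 0 := by
    refine HasFDerivAt.comp_hasDerivAt (f := fun s : ℝ => x + s • v) 0 ?_ (hasDerivAt_line x v 0)
    simpa using h1.hasFDerivAt
  simpa using h2.clm_apply (hasDerivAt_const (0 : ℝ) v)

lemma ContDiffAt.fderiv_fderiv_eq_of_line {f : E → ℝ} {x v : E} {g' : ℝ → ℝ} {b : ℝ}
    (hf : ContDiffAt ℝ 2 f x)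
    (h1 : ∀ᶠ s in nhds (0 : ℝ), HasDerivAt (fun s : ℝ => f (x + s • v)) (g' s) s)
    (h2 : HasDerivAt g' b 0) : fderiv ℝ (fderiv ℝ f) x v v = b := by
  have h : g' =ᶠ[nhds 0] fun s => fderiv ℝ f (x + s • v) v := by
    filter_upwards [h1, hf.eventually_hasDerivAt_line v] with s hs hs' using hs.unique hs'
  exact ((hf.hasDerivAt_fderiv_line v).congr_of_eventuallyEq h).unique h2

lemma lap_eq_sum {n : ℕ} {f : EuclideanSpace ℝ (Fin n) → ℝ} {x : EuclideanSpace ℝ (Fin n)}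
    (hf : ContDiffAt ℝ 2 f x) :
    lap f x = ∑ i : Fin n, fderiv ℝ (fderiv ℝ f) x (EuclideanSpace.single i 1)
      (EuclideanSpace.single i 1) := by
  have h1 : DifferentiableAt ℝ (fderiv ℝ f) x :=
    (hf.fderiv_right (m := 1) (by norm_num)).differentiableAt (by simp)
  unfold lap
  refine Finset.sum_congr rfl fun i _ => ?_
  rw [fderiv_clm_apply h1 (by fun_prop)]
  simp

end SecondDerivative

section HalfSpace

variable {n : ℕ}

lemma euclidean_sum_single (x : EuclideanSpace ℝ (Fin n)) :
    ∑ i, x i • EuclideanSpace.single i (1 : ℝ) = x := by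
  simpa using (EuclideanSpace.basisFun (Fin n) ℝ).sum_repr x

lemma euclidean_abs_apply_le (x : EuclideanSpace ℝ (Fin n)) (i : Fin n) : |x i| ≤ ‖x‖ := by
  simpa using PiLp.norm_apply_le x i

/-- The trace of a bilinear form is invariant under the reflection along a unit vector. -/
lemma sum_reflection_eq (B : EuclideanSpace ℝ (Fin n) →L[ℝ] EuclideanSpace ℝ (Fin n) →L[ℝ] ℝ)
    (e : EuclideanSpace ℝ (Fin n)) (he : ‖e‖ = 1) :
    ∑ i, B (EuclideanSpace.single i 1 - (2 * e i) • e) (EuclideanSpace.single i 1 - (2 * e i) • e)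
      = ∑ i, B (EuclideanSpace.single i 1) (EuclideanSpace.single i 1) := by
  have hs : ∑ i, e i ^ 2 = 1 := by
    have := EuclideanSpace.norm_sq_eq e
    rw [he] at this
    simpa using this.symm
  have h1 : ∑ i, e i * B (EuclideanSpace.single i 1) e = B e e := by
    have h := congrArg (fun z => B z e) (euclidean_sum_single e)
    simpa only [map_sum, map_smul, sum_apply, smul_apply,
      smul_eq_mul] using h
  have h2 : ∑ i, e i * B e (EuclideanSpace.single i 1) = B e e := by
    have h := congrArg (fun z => B e z) (euclidean_sum_single e)
    simpa only [map_sum, map_smul, sum_apply, smul_apply,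
      smul_eq_mul] using h
  have h3 : ∀ i, B (EuclideanSpace.single i 1 - (2 * e i) • e)
      (EuclideanSpace.single i 1 - (2 * e i) • e) = B (EuclideanSpace.single i 1)
      (EuclideanSpace.single i 1) - 2 * (e i * B (EuclideanSpace.single i 1) e)
      - 2 * (e i * B e (EuclideanSpace.single i 1)) + 4 * B e e * e i ^ 2 := by
    intro i; simp; ring
  simp_rw [h3]
  rw [Finset.sum_add_distrib, Finset.sum_sub_distrib, Finset.sum_sub_distrib, ← Finset.mul_sum,
    ← Finset.mul_sum, ← Finset.mul_sum, h1, h2, hs]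
  ring

lemma mem_openHalf {hn : 0 < n} {x : EuclideanSpace ℝ (Fin n)} :
    x ∈ openHalf n hn ↔ 0 < x ⟨0, hn⟩ := Iff.rfl

lemma mem_closedHalf {hn : 0 < n} {x : EuclideanSpace ℝ (Fin n)} :
    x ∈ closedHalf n hn ↔ 0 ≤ x ⟨0, hn⟩ := Iff.rfl

lemma isOpen_openHalf (hn : 0 < n) : IsOpen (openHalf n hn) :=
  isOpen_lt continuous_const (by fun_prop)

lemma isClosed_closedHalf (hn : 0 < n) : IsClosed (closedHalf n hn) :=
  isClosed_le continuous_const (by fun_prop)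

lemma openHalf_subset_closedHalf (hn : 0 < n) : openHalf n hn ⊆ closedHalf n hn :=
  fun _ hx => mem_closedHalf.2 (mem_openHalf.1 hx).le

lemma add_smul_single_mem_closedHalf (hn : 0 < n) {x : EuclideanSpace ℝ (Fin n)}
    (hx : x ∈ closedHalf n hn) {s : ℝ} (hs : 0 ≤ s) :
    x + s • EuclideanSpace.single ⟨0, hn⟩ (1 : ℝ) ∈ closedHalf n hn := by
  simp only [mem_closedHalf] at hx ⊢
  simp
  positivity

lemma add_smul_single_mem_openHalf (hn : 0 < n) {x : EuclideanSpace ℝ (Fin n)}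
    (hx : x ∈ closedHalf n hn) {s : ℝ} (hs : 0 < s) :
    x + s • EuclideanSpace.single ⟨0, hn⟩ (1 : ℝ) ∈ openHalf n hn := by
  simp only [mem_closedHalf, mem_openHalf] at hx ⊢
  simp
  positivity

lemma closedHalf_subset_closure_openHalf (hn : 0 < n) :
    closedHalf n hn ⊆ closure (openHalf n hn) := by
  intro x hx
  have h : Filter.Tendsto (fun s : ℝ => x + s • EuclideanSpace.single ⟨0, hn⟩ (1 : ℝ))
      (nhdsWithin 0 (Ioi 0)) (nhds x) := by
    have := (hasDerivAt_line x (EuclideanSpace.single ⟨0, hn⟩ (1 : ℝ)) 0).continuousAt.tendsto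
    simp only [zero_smul, add_zero] at this
    exact this.mono_left nhdsWithin_le_nhds
  refine mem_closure_of_tendsto h ?_
  filter_upwards [self_mem_nhdsWithin] with s hs
  exact add_smul_single_mem_openHalf hn hx hs

lemma uniqueDiffOn_closedHalf (hn : 0 < n) : UniqueDiffOn ℝ (closedHalf n hn) := by
  refine uniqueDiffOn_convex ?_ ?_
  · intro x hx y hy a b ha hb _
    simp only [mem_closedHalf] at hx hy ⊢
    simp
    positivity
  · refine ⟨EuclideanSpace.single ⟨0, hn⟩ 1, ?_⟩
    exact interior_maximal (openHalf_subset_closedHalf hn) (isOpen_openHalf hn)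
      (by simp [mem_openHalf])

end HalfSpace

lemma hasDerivAt_norm_line {E : Type*} [NormedAddCommGroup E] [InnerProductSpace ℝ E]
    {z : E} (hz : z ≠ 0) (w : E) :
    HasDerivAt (fun s : ℝ => ‖z + s • w‖) (inner ℝ z w / ‖z‖) 0 := by
  have h := (hasDerivAt_line z w 0).norm_sq.sqrt (by simpa using hz)
  have hz' : ‖z‖ ≠ 0 := norm_ne_zero_iff.2 hz
  simp only [zero_smul, add_zero, Real.sqrt_sq (norm_nonneg _)] at h
  refine h.congr_deriv ?_
  field_simp

section Doubling

variable {n : ℕ}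

/-- The penalized doubled function `U(x,t) - U(y,t) - φ(|x-y|) - η (|x|² + t² - xᵢ - yᵢ)`. -/
noncomputable def doublingFun (i : Fin n) (U : EuclideanSpace ℝ (Fin n) × ℝ → ℝ) (φ : ℝ → ℝ)
    (η : ℝ) (x y : EuclideanSpace ℝ (Fin n)) (t : ℝ) : ℝ :=
  U (x, t) - U (y, t) - φ ‖x - y‖ - η * (‖x‖ ^ 2 + t ^ 2 - x i - y i)

lemma hasDerivAt_apply_line (x v : EuclideanSpace ℝ (Fin n)) (i : Fin n) (s : ℝ) :
    HasDerivAt (fun s : ℝ => (x + s • v) i) (v i) s := by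
  have h := ((hasDerivAt_id s).mul_const (v i)).const_add (x i)
  refine (h.congr_of_eventuallyEq (Filter.Eventually.of_forall fun s => ?_)).congr_deriv ?_ <;> simp

lemma hasDerivAt_norm_sq_line (x v : EuclideanSpace ℝ (Fin n)) (s : ℝ) :
    HasDerivAt (fun s : ℝ => ‖x + s • v‖ ^ 2) (2 * inner ℝ (x + s • v) v) s :=
  (hasDerivAt_line x v s).norm_sq

lemma hasDerivAt_profile_norm_line {φ : ℝ → ℝ} {d : ℝ} {z : EuclideanSpace ℝ (Fin n)}
    (hφ : HasDerivAt φ d ‖z‖) (hz : z ≠ 0) (w : EuclideanSpace ℝ (Fin n)) :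
    HasDerivAt (fun s : ℝ => φ ‖z + s • w‖) (d * (inner ℝ z w / ‖z‖)) 0 := by
  refine HasDerivAt.comp (h := fun s : ℝ => ‖z + s • w‖) (h₂ := φ) 0 ?_ (hasDerivAt_norm_line hz w)
  simpa using hφ

lemma tendsto_line (x v : EuclideanSpace ℝ (Fin n)) :
    Filter.Tendsto (fun s : ℝ => x + s • v) (nhds 0) (nhds x) := by
  simpa using (hasDerivAt_line x v 0).continuousAt.tendsto

/-- The first-order conditions exclude maxima of the doubled function with `x` on the boundary. -/
lemma doublingFun_max_left_mem_openHalf {hn : 0 < n} {U : EuclideanSpace ℝ (Fin n) × ℝ → ℝ}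
    {φ : ℝ → ℝ} {d r₀ η t : ℝ} {x y : EuclideanSpace ℝ (Fin n)}
    (hN : x ⟨0, hn⟩ = 0 → HasDerivWithinAt
      (fun s : ℝ => U (x + s • EuclideanSpace.single ⟨0, hn⟩ (1 : ℝ), t)) 0 (Ici 0) 0)
    (hφ : HasDerivAt φ d ‖x - y‖) (hd : 0 ≤ d) (hη : 0 < η)
    (hx : x ∈ closedHalf n hn) (hy : y ∈ closedHalf n hn) (hxy : x ≠ y) (hr : ‖x - y‖ < r₀)
    (hmax : ∀ x' ∈ closedHalf n hn, ‖x' - y‖ ≤ r₀ →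
      doublingFun ⟨0, hn⟩ U φ η x' y t ≤ doublingFun ⟨0, hn⟩ U φ η x y t) :
    x ∈ openHalf n hn := by
  rw [mem_openHalf]
  refine lt_of_le_of_ne (mem_closedHalf.1 hx) fun h0 => ?_
  set e : EuclideanSpace ℝ (Fin n) := EuclideanSpace.single ⟨0, hn⟩ (1 : ℝ) with he
  have hz : x - y ≠ 0 := sub_ne_zero.2 hxy
  have hder := (((hN h0.symm).sub_const (U (y, t))).sub
    (hasDerivAt_profile_norm_line hφ hz e).hasDerivWithinAt).sub
    (((((hasDerivAt_norm_sq_line x e 0).add_const (t ^ 2)).sub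
      (hasDerivAt_apply_line x e ⟨0, hn⟩ 0)).sub_const (y ⟨0, hn⟩)).const_mul η).hasDerivWithinAt
  have hle := hasDerivWithinAt_Ici_nonpos hder ?_
  · have hin : inner ℝ (x - y) e = - y ⟨0, hn⟩ := by
      simp [he, EuclideanSpace.inner_single_right, ← h0]
    have hin2 : inner ℝ x e = 0 := by
      simp [he, EuclideanSpace.inner_single_right, ← h0]
    have hee : e ⟨0, hn⟩ = 1 := by simp [he]
    rw [hin, hee, zero_smul, add_zero, hin2] at hle
    have : 0 ≤ d * (y ⟨0, hn⟩ / ‖x - y‖) :=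
      mul_nonneg hd (div_nonneg (mem_closedHalf.1 hy) (norm_nonneg _))
    rw [neg_div] at hle
    nlinarith
  · have hev : ∀ᶠ s : ℝ in nhds 0, ‖x + s • e - y‖ < r₀ :=
      (((tendsto_line x e).sub_const y).norm).eventually_lt_const hr
    filter_upwards [self_mem_nhdsWithin, nhdsWithin_le_nhds hev] with s hs hs'
    have := hmax _ (add_smul_single_mem_closedHalf hn hx (le_of_lt hs)) hs'.le
    simp only [doublingFun] at this
    simpa [he, sub_add_eq_add_sub] using this

/-- The first-order conditions exclude maxima of the doubled function with `y` on the boundary. -/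
lemma doublingFun_max_right_mem_openHalf {hn : 0 < n} {U : EuclideanSpace ℝ (Fin n) × ℝ → ℝ}
    {φ : ℝ → ℝ} {d r₀ η t : ℝ} {x y : EuclideanSpace ℝ (Fin n)}
    (hN : y ⟨0, hn⟩ = 0 → HasDerivWithinAt
      (fun s : ℝ => U (y + s • EuclideanSpace.single ⟨0, hn⟩ (1 : ℝ), t)) 0 (Ici 0) 0)
    (hφ : HasDerivAt φ d ‖x - y‖) (hd : 0 ≤ d) (hη : 0 < η)
    (hx : x ∈ closedHalf n hn) (hy : y ∈ closedHalf n hn) (hxy : x ≠ y) (hr : ‖x - y‖ < r₀)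
    (hmax : ∀ y' ∈ closedHalf n hn, ‖x - y'‖ ≤ r₀ →
      doublingFun ⟨0, hn⟩ U φ η x y' t ≤ doublingFun ⟨0, hn⟩ U φ η x y t) :
    y ∈ openHalf n hn := by
  rw [mem_openHalf]
  refine lt_of_le_of_ne (mem_closedHalf.1 hy) fun h0 => ?_
  set e : EuclideanSpace ℝ (Fin n) := EuclideanSpace.single ⟨0, hn⟩ (1 : ℝ) with he
  have hz : x - y ≠ 0 := sub_ne_zero.2 hxy
  have hder := (((hN h0.symm).const_sub (U (x, t))).sub
    (hasDerivAt_profile_norm_line hφ hz (-e)).hasDerivWithinAt).sub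
    (((hasDerivAt_apply_line y e ⟨0, hn⟩ 0).const_sub
      (‖x‖ ^ 2 + t ^ 2 - x ⟨0, hn⟩)).const_mul η).hasDerivWithinAt
  have hle := hasDerivWithinAt_Ici_nonpos hder ?_
  · have hin : inner ℝ (x - y) (-e) = - x ⟨0, hn⟩ := by
      simp [he, EuclideanSpace.inner_single_right, ← h0]
    have hee : e ⟨0, hn⟩ = 1 := by simp [he]
    rw [hin, hee] at hle
    have : 0 ≤ d * (x ⟨0, hn⟩ / ‖x - y‖) :=
      mul_nonneg hd (div_nonneg (mem_closedHalf.1 hx) (norm_nonneg _))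
    rw [neg_div] at hle
    nlinarith
  · have hev : ∀ᶠ s : ℝ in nhds 0, ‖x - (y + s • e)‖ < r₀ :=
      (((tendsto_line y e).const_sub x).norm).eventually_lt_const hr
    filter_upwards [self_mem_nhdsWithin, nhdsWithin_le_nhds hev] with s hs hs'
    have := hmax _ (add_smul_single_mem_closedHalf hn hy (le_of_lt hs)) hs'.le
    simp only [doublingFun] at this
    have h3 : x - y + s • -e = x - (y + s • e) := by
      rw [smul_neg]; abel
    simp only [Pi.sub_apply, h3]
    simpa [he] using this

lemma opNorm_le_of_apply_eq {p : EuclideanSpace ℝ (Fin n) →L[ℝ] ℝ} {m : ℝ} (hm : 0 ≤ m)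
    (h : ∀ w, p w ≤ m * ‖w‖) : ‖p‖ ≤ m := by
  refine p.opNorm_le_bound hm fun w => ?_
  rw [Real.norm_eq_abs, abs_le]
  have h1 := h w
  have h2 := h (-w)
  rw [map_neg, norm_neg] at h2
  constructor <;> linarith

/-- Gradient bound in the first variable at an interior maximum of the doubled function. -/
lemma doublingFun_max_norm_fderiv_left {i : Fin n} {U : EuclideanSpace ℝ (Fin n) × ℝ → ℝ}
    {φ : ℝ → ℝ} {d η t : ℝ} {x y : EuclideanSpace ℝ (Fin n)}
    (hU : DifferentiableAt ℝ (fun x => U (x, t)) x)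
    (hφ : HasDerivAt φ d ‖x - y‖) (hd : 0 ≤ d) (hη : 0 < η) (hη1 : η ≤ 1) (hηx : η * ‖x‖ ≤ 1)
    (hxy : x ≠ y)
    (hmax : IsLocalMax (fun x' => doublingFun i U φ η x' y t) x) :
    ‖fderiv ℝ (fun x => U (x, t)) x‖ ≤ d + 3 := by
  refine opNorm_le_of_apply_eq (by linarith) fun w => ?_
  have hz : x - y ≠ 0 := sub_ne_zero.2 hxy
  have hUl : HasDerivAt (fun s : ℝ => U (x + s • w, t)) (fderiv ℝ (fun x => U (x, t)) x w) 0 := by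
    refine HasFDerivAt.comp_hasDerivAt (l := fun x => U (x, t)) (f := fun s : ℝ => x + s • w) 0 ?_
      (hasDerivAt_line x w 0)
    simpa using hU.hasFDerivAt
  have hder := ((hUl.sub_const (U (y, t))).sub
    (hasDerivAt_profile_norm_line hφ hz w)).sub
    (((((hasDerivAt_norm_sq_line x w 0).add_const (t ^ 2)).sub
      (hasDerivAt_apply_line x w i 0)).sub_const (y i)).const_mul η)
  have hloc : IsLocalMax (fun s : ℝ => doublingFun i U φ η (x + s • w) y t) 0 := by
    have := (tendsto_line x w).eventually hmax
    simpa [IsLocalMax, IsMaxFilter] using this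
  have h0 := hloc.hasDerivAt_eq_zero (hder.congr_of_eventuallyEq
    (Filter.Eventually.of_forall fun s => by simp [doublingFun, sub_add_eq_add_sub]))
  rw [zero_smul, add_zero] at h0
  have hr : 0 < ‖x - y‖ := norm_pos_iff.2 hz
  have h1 : inner ℝ (x - y) w / ‖x - y‖ ≤ ‖w‖ := by
    rw [div_le_iff₀ hr, mul_comm]; exact real_inner_le_norm _ _
  have h2 : inner ℝ x w ≤ ‖x‖ * ‖w‖ := real_inner_le_norm _ _
  have h3 := (abs_le.1 (euclidean_abs_apply_le w i)).1
  have h4 : d * (inner ℝ (x - y) w / ‖x - y‖) ≤ d * ‖w‖ := by gcongr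
  have h5 : η * inner ℝ x w ≤ ‖w‖ := by
    calc η * inner ℝ x w ≤ η * (‖x‖ * ‖w‖) := by gcongr
      _ = (η * ‖x‖) * ‖w‖ := by ring
      _ ≤ 1 * ‖w‖ := by gcongr
      _ = ‖w‖ := one_mul _
  have h6 : η * (-(w i)) ≤ 1 * ‖w‖ := by
    calc η * (-(w i)) ≤ η * ‖w‖ := by gcongr; linarith
      _ ≤ 1 * ‖w‖ := by gcongr
  nlinarith

/-- Gradient bound in the second variable at an interior maximum of the doubled function. -/
lemma doublingFun_max_norm_fderiv_right {i : Fin n} {U : EuclideanSpace ℝ (Fin n) × ℝ → ℝ}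
    {φ : ℝ → ℝ} {d η t : ℝ} {x y : EuclideanSpace ℝ (Fin n)}
    (hU : DifferentiableAt ℝ (fun x => U (x, t)) y)
    (hφ : HasDerivAt φ d ‖x - y‖) (hd : 0 ≤ d) (hη : 0 < η) (hη1 : η ≤ 1)
    (hxy : x ≠ y)
    (hmax : IsLocalMax (fun y' => doublingFun i U φ η x y' t) y) :
    ‖fderiv ℝ (fun x => U (x, t)) y‖ ≤ d + 3 := by
  refine opNorm_le_of_apply_eq (by linarith) fun w => ?_
  have hz : x - y ≠ 0 := sub_ne_zero.2 hxy
  have hUl : HasDerivAt (fun s : ℝ => U (y + s • w, t)) (fderiv ℝ (fun x => U (x, t)) y w) 0 := by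
    refine HasFDerivAt.comp_hasDerivAt (l := fun x => U (x, t)) (f := fun s : ℝ => y + s • w) 0 ?_
      (hasDerivAt_line y w 0)
    simpa using hU.hasFDerivAt
  have hder := ((hUl.const_sub (U (x, t))).sub
    (hasDerivAt_profile_norm_line hφ hz (-w))).sub
    (((hasDerivAt_apply_line y w i 0).const_sub (‖x‖ ^ 2 + t ^ 2 - x i)).const_mul η)
  have hloc : IsLocalMax (fun s : ℝ => doublingFun i U φ η x (y + s • w) t) 0 := by
    have := (tendsto_line y w).eventually hmax
    simpa [IsLocalMax, IsMaxFilter] using this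
  have h0 := hloc.hasDerivAt_eq_zero (hder.congr_of_eventuallyEq
    (Filter.Eventually.of_forall fun s => by
      have h3 : x - y + s • -w = x - (y + s • w) := by rw [smul_neg]; abel
      simp only [doublingFun, Pi.sub_apply, h3]))
  have hr : 0 < ‖x - y‖ := norm_pos_iff.2 hz
  have h1 : -(inner ℝ (x - y) (-w) / ‖x - y‖) ≤ ‖w‖ := by
    rw [inner_neg_right, neg_div, neg_neg, div_le_iff₀ hr, mul_comm]; exact real_inner_le_norm _ _
  have h3 := (abs_le.1 (euclidean_abs_apply_le w i)).2
  have h4 : d * -(inner ℝ (x - y) (-w) / ‖x - y‖) ≤ d * ‖w‖ := by gcongr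
  have h6 : η * w i ≤ 1 * ‖w‖ := by
    calc η * (w i) ≤ η * ‖w‖ := by gcongr
      _ ≤ 1 * ‖w‖ := by gcongr
  nlinarith [norm_nonneg w]

/-- The second-order condition at an interior maximum of the doubled function, tested against
simultaneous translations coupled by the reflection along `x - y`. -/
lemma doublingFun_max_lap_sub_lap_le {i : Fin n} {U : EuclideanSpace ℝ (Fin n) × ℝ → ℝ}
    {φ d : ℝ → ℝ} {d₂ η t : ℝ} {x y : EuclideanSpace ℝ (Fin n)}
    (hUx : ContDiffAt ℝ 2 (fun x => U (x, t)) x) (hUy : ContDiffAt ℝ 2 (fun x => U (x, t)) y)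
    (hφ : ∀ r, 0 < r → HasDerivAt φ (d r) r) (hd : HasDerivAt d d₂ ‖x - y‖)
    (hxy : x ≠ y)
    (hmax : IsLocalMax (fun p : EuclideanSpace ℝ (Fin n) × EuclideanSpace ℝ (Fin n) =>
      doublingFun i U φ η p.1 p.2 t) (x, y)) :
    lap (fun x => U (x, t)) x - lap (fun x => U (x, t)) y ≤ 4 * d₂ + 2 * η * n := by
  have hr : 0 < ‖x - y‖ := norm_pos_iff.2 (sub_ne_zero.2 hxy)
  set r := ‖x - y‖ with hrdef
  set e : EuclideanSpace ℝ (Fin n) := r⁻¹ • (x - y) with he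
  have hze : x - y = r • e := by rw [he, smul_smul, mul_inv_cancel₀ hr.ne', one_smul]
  have hen : ‖e‖ = 1 := by
    rw [he, norm_smul, norm_inv, Real.norm_of_nonneg hr.le, ← hrdef, inv_mul_cancel₀ hr.ne']
  have hs : ∑ j, e j ^ 2 = 1 := by
    have := EuclideanSpace.norm_sq_eq e
    rw [hen] at this
    simpa using this.symm
  have key : ∀ j : Fin n, fderiv ℝ (fderiv ℝ fun x => U (x, t)) x (EuclideanSpace.single j 1)
      (EuclideanSpace.single j 1) - fderiv ℝ (fderiv ℝ fun x => U (x, t)) y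
      (EuclideanSpace.single j 1 - (2 * e j) • e) (EuclideanSpace.single j 1 - (2 * e j) • e)
      - 4 * d₂ * e j ^ 2 - 2 * η ≤ 0 := by
    intro j
    set v : EuclideanSpace ℝ (Fin n) := EuclideanSpace.single j 1 with hv
    set w : EuclideanSpace ℝ (Fin n) := v - (2 * e j) • e with hw
    have hlin : ∀ s : ℝ, HasDerivAt (fun s : ℝ => r + s * (2 * e j)) (2 * e j) s := fun s => by
      simpa using ((hasDerivAt_id s).mul_const (2 * e j)).const_add r
    have hpos : ∀ᶠ s : ℝ in nhds 0, 0 < r + s * (2 * e j) := by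
      refine (hlin 0).continuousAt.tendsto.eventually_const_lt ?_
      simpa using hr
    have hnorm : ∀ s : ℝ, 0 < r + s * (2 * e j) →
        ‖(x + s • v) - (y + s • w)‖ = r + s * (2 * e j) := by
      intro s hs0
      have : (x + s • v) - (y + s • w) = (r + s * (2 * e j)) • e := by
        rw [add_smul, ← hze, hw, smul_sub, smul_smul]; abel
      rw [this, norm_smul, hen, mul_one, Real.norm_of_nonneg hs0.le]
    have hev : ∀ᶠ s : ℝ in nhds 0, HasDerivAt
        (fun s => doublingFun i U φ η (x + s • v) (y + s • w) t)
        (fderiv ℝ (fun x => U (x, t)) (x + s • v) v - fderiv ℝ (fun x => U (x, t)) (y + s • w) w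
          - d (r + s * (2 * e j)) * (2 * e j)
          - η * (2 * inner ℝ (x + s • v) v - v i - w i)) s := by
      filter_upwards [hUx.eventually_hasDerivAt_line v, hUy.eventually_hasDerivAt_line w,
        hpos.eventually_nhds] with s h1 h2 h3
      have h := ((h1.sub h2).sub ((hφ _ h3.self_of_nhds).comp s (hlin s))).sub
        (((((hasDerivAt_norm_sq_line x v s).add_const (t ^ 2)).sub
          (hasDerivAt_apply_line x v i s)).sub (hasDerivAt_apply_line y w i s)).const_mul η)
      refine h.congr_of_eventuallyEq ?_
      filter_upwards [h3] with s' hs'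
      simp only [doublingFun, hnorm s' hs']
      rfl
    have hinn : HasDerivAt (fun s : ℝ => inner ℝ (x + s • v) v) 1 0 := by
      have h := ((hasDerivAt_line x v 0).inner ℝ (hasDerivAt_const (0 : ℝ) v))
      refine h.congr_deriv ?_
      simp [hv]
    have hd0 : HasDerivAt (fun s : ℝ => d (r + s * (2 * e j))) (d₂ * (2 * e j)) 0 :=
      HasDerivAt.comp (h := fun s : ℝ => r + s * (2 * e j)) (h₂ := d) 0 (by simpa using hd) (hlin 0)
    have h2 := (((hUx.hasDerivAt_fderiv_line v).sub (hUy.hasDerivAt_fderiv_line w)).sub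
      (hd0.mul_const (2 * e j))).sub
      ((((hinn.const_mul 2).sub_const (v i)).sub_const (w i)).const_mul η)
    have hloc : IsLocalMax (fun s : ℝ => doublingFun i U φ η (x + s • v) (y + s • w) t) 0 := by
      have := ((tendsto_line x v).prodMk_nhds (tendsto_line y w)).eventually hmax
      simpa [IsLocalMax, IsMaxFilter] using this
    have := hloc.second_deriv_nonpos hev h2
    linarith
  have hsum := Finset.sum_nonpos fun j (_ : j ∈ Finset.univ) => key j
  rw [Finset.sum_sub_distrib, Finset.sum_sub_distrib, Finset.sum_sub_distrib,
    sum_reflection_eq _ e hen, ← Finset.mul_sum, hs, ← lap_eq_sum hUx, ← lap_eq_sum hUy] at hsum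
  simp at hsum
  linarith

end Doubling

section Lipschitz

variable {n : ℕ}

/-- There is no maximum of the doubled function at a point with `0 < |x - y| < r₀`, if `U` solves
a heat equation with quadratic gradient growth and homogeneous Neumann data. -/
lemma not_doublingFun_max {hn : 0 < n} {U : EuclideanSpace ℝ (Fin n) × ℝ → ℝ} {C : ℝ}
    (hC : 0 ≤ C)
    (hN : ∀ x : EuclideanSpace ℝ (Fin n), x ⟨0, hn⟩ = 0 → ∀ t, HasDerivWithinAt
      (fun s : ℝ => U (x + s • EuclideanSpace.single ⟨0, hn⟩ (1 : ℝ), t)) 0 (Ici 0) 0)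
    (hreg : ∀ x ∈ openHalf n hn, ∀ t, ContDiffAt ℝ 2 (fun y => U (y, t)) x)
    (heq : ∀ x ∈ openHalf n hn, ∀ t, ∃ τ, HasDerivAt (fun s => U (x, s)) τ t ∧
      |τ - lap (fun y => U (y, t)) x| ≤ C * (1 + ‖fderiv ℝ (fun y => U (y, t)) x‖ ^ 2))
    {φ d : ℝ → ℝ} {r₀ η t : ℝ} {x y : EuclideanSpace ℝ (Fin n)}
    (hφ : ∀ r, 0 < r → HasDerivAt φ (d r) r)
    (hd : ∀ r, 0 < r → HasDerivAt d (-(1 + n + 9 * C) * d r ^ 2) r)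
    (hd1 : ∀ r, 0 < r → r ≤ r₀ → 1 ≤ d r)
    (hη : 0 < η) (hη1 : η ≤ 1) (hηx : η * ‖x‖ ≤ 1) (hηt : |η * t| ≤ 1)
    (hx : x ∈ closedHalf n hn) (hy : y ∈ closedHalf n hn) (hxy : x ≠ y) (hr : ‖x - y‖ < r₀) :
    ¬ ∀ x' ∈ closedHalf n hn, ∀ y' ∈ closedHalf n hn, ∀ t', ‖x' - y'‖ ≤ r₀ →
      doublingFun ⟨0, hn⟩ U φ η x' y' t' ≤ doublingFun ⟨0, hn⟩ U φ η x y t := by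
  intro hmax
  have hr0 : 0 < ‖x - y‖ := norm_pos_iff.2 (sub_ne_zero.2 hxy)
  have hdr := hd1 _ hr0 hr.le
  have hxo : x ∈ openHalf n hn := doublingFun_max_left_mem_openHalf (fun h => hN x h t)
    (hφ _ hr0) (by linarith) hη hx hy hxy hr fun x' hx' h => hmax x' hx' y hy t h
  have hyo : y ∈ openHalf n hn := doublingFun_max_right_mem_openHalf (fun h => hN y h t)
    (hφ _ hr0) (by linarith) hη hx hy hxy hr fun y' hy' h => hmax x hx y' hy' t h
  have hcl : ∀ z ∈ openHalf n hn, ∀ᶠ z' in nhds z, z' ∈ closedHalf n hn := fun z hz =>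
    Filter.mem_of_superset ((isOpen_openHalf hn).mem_nhds hz) (openHalf_subset_closedHalf hn)
  have hloc : IsLocalMax (fun p : EuclideanSpace ℝ (Fin n) × EuclideanSpace ℝ (Fin n) =>
      doublingFun ⟨0, hn⟩ U φ η p.1 p.2 t) (x, y) := by
    have h3 : ∀ᶠ p : EuclideanSpace ℝ (Fin n) × EuclideanSpace ℝ (Fin n) in nhds (x, y),
        ‖p.1 - p.2‖ < r₀ := by
      have : Continuous fun p : EuclideanSpace ℝ (Fin n) × EuclideanSpace ℝ (Fin n) =>
        ‖p.1 - p.2‖ := by fun_prop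
      exact (this.tendsto (x, y)).eventually_lt_const hr
    filter_upwards [h3, (continuous_fst.tendsto (x, y)).eventually (hcl x hxo),
      (continuous_snd.tendsto (x, y)).eventually (hcl y hyo)] with p h1 h2 h3
    exact hmax _ h2 _ h3 t h1.le
  have hlocx : IsLocalMax (fun x' => doublingFun ⟨0, hn⟩ U φ η x' y t) x :=
    (((continuous_id.prodMk continuous_const).tendsto x).eventually hloc :)
  have hlocy : IsLocalMax (fun y' => doublingFun ⟨0, hn⟩ U φ η x y' t) y :=
    (((continuous_const.prodMk continuous_id).tendsto y).eventually hloc :)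
  have hgx := doublingFun_max_norm_fderiv_left ((hreg x hxo t).differentiableAt (by simp))
    (hφ _ hr0) (by linarith) hη hη1 hηx hxy hlocx
  have hgy := doublingFun_max_norm_fderiv_right ((hreg y hyo t).differentiableAt (by simp))
    (hφ _ hr0) (by linarith) hη hη1 hxy hlocy
  have hlap := doublingFun_max_lap_sub_lap_le (hreg x hxo t) (hreg y hyo t) hφ (hd _ hr0) hxy hloc
  obtain ⟨τx, hτx, hbx⟩ := heq x hxo t
  obtain ⟨τy, hτy, hby⟩ := heq y hyo t
  have hlt : IsLocalMax (fun t' => doublingFun ⟨0, hn⟩ U φ η x y t') t :=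
    Filter.Eventually.of_forall fun t' => hmax x hx y hy t' hr.le
  have hdt := ((hτx.sub hτy).sub_const (φ ‖x - y‖)).sub
    ((((((hasDerivAt_id t).pow 2).const_add (‖x‖ ^ 2)).sub_const (x ⟨0, hn⟩)).sub_const
      (y ⟨0, hn⟩)).const_mul η)
  have ht0 := hlt.hasDerivAt_eq_zero hdt
  simp at ht0
  have hgx2 : ‖fderiv ℝ (fun x => U (x, t)) x‖ ^ 2 ≤ (d ‖x - y‖ + 3) ^ 2 := by gcongr
  have hgy2 : ‖fderiv ℝ (fun x => U (x, t)) y‖ ^ 2 ≤ (d ‖x - y‖ + 3) ^ 2 := by gcongr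
  have hbx' := (abs_le.1 (hbx.trans (mul_le_mul_of_nonneg_left
    (add_le_add_right hgx2 1) hC))).2
  have hby' := (abs_le.1 (hby.trans (mul_le_mul_of_nonneg_left
    (add_le_add_right hgy2 1) hC))).1
  set D := d ‖x - y‖
  have hDC : C * (1 + (D + 3) ^ 2) ≤ C * (17 * D ^ 2) := by
    gcongr; nlinarith
  have hηn : η * n ≤ 1 * n * D ^ 2 := by
    have h1 : η * n ≤ 1 * n := by gcongr
    have h2 : (1 : ℝ) * n * 1 ≤ 1 * n * D ^ 2 := by gcongr; nlinarith
    linarith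
  have h1 := (abs_le.1 hηt).1
  nlinarith [mul_nonneg hC (sq_nonneg D)]

set_option maxHeartbeats 800000 in
/-- A bounded function on the half-space with homogeneous Neumann data, solving a heat equation
up to an error of quadratic growth in the gradient, is Lipschitz in space, uniformly in time. -/
theorem exists_lipschitz_of_neumann {hn : 0 < n} {U : EuclideanSpace ℝ (Fin n) × ℝ → ℝ}
    {C K : ℝ} (hC : 0 ≤ C) (hK : 0 ≤ K)
    (hcont : ContinuousOn U (closedHalf n hn ×ˢ (univ : Set ℝ)))
    (hosc : ∀ x ∈ closedHalf n hn, ∀ y ∈ closedHalf n hn, ∀ t, U (x, t) - U (y, t) ≤ K)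
    (hN : ∀ x : EuclideanSpace ℝ (Fin n), x ⟨0, hn⟩ = 0 → ∀ t, HasDerivWithinAt
      (fun s : ℝ => U (x + s • EuclideanSpace.single ⟨0, hn⟩ (1 : ℝ), t)) 0 (Ici 0) 0)
    (hreg : ∀ x ∈ openHalf n hn, ∀ t, ContDiffAt ℝ 2 (fun y => U (y, t)) x)
    (heq : ∀ x ∈ openHalf n hn, ∀ t, ∃ τ, HasDerivAt (fun s => U (x, s)) τ t ∧
      |τ - lap (fun y => U (y, t)) x| ≤ C * (1 + ‖fderiv ℝ (fun y => U (y, t)) x‖ ^ 2)) :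
    ∃ L, ∀ x ∈ closedHalf n hn, ∀ y ∈ closedHalf n hn, ∀ t,
      U (x, t) - U (y, t) ≤ L * ‖x - y‖ := by
  obtain ⟨φ, d, r₀, L, hr0, hr1, hφ0, hφH, hφc, hφ, hd, hd1, hL, hφn⟩ :=
    exists_log_profile (1 + n + 9 * C) (K + 3) (by
      have : (0 : ℝ) ≤ n := n.cast_nonneg
      linarith)
  refine ⟨L, fun x₁ hx₁ y₁ hy₁ t₁ => ?_⟩
  have hL0 : 0 ≤ L := by
    have := hL r₀ hr0.le
    by_contra! h
    nlinarith
  rcases le_or_gt r₀ ‖x₁ - y₁‖ with hfar | hnear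
  · calc U (x₁, t₁) - U (y₁, t₁) ≤ K := hosc _ hx₁ _ hy₁ _
      _ ≤ L * r₀ := by linarith [hL r₀ hr0.le]
      _ ≤ L * ‖x₁ - y₁‖ := by gcongr
  refine le_trans ?_ (hL _ (norm_nonneg _))
  by_contra! hlt
  set σ := U (x₁, t₁) - U (y₁, t₁) - φ ‖x₁ - y₁‖ with hσ
  have hσ0 : 0 < σ := by linarith
  set Q : ℝ := 2 * K + 6 with hQ
  have hQ0 : 0 < Q := by linarith
  set P : ℝ := ‖x₁‖ ^ 2 + t₁ ^ 2 - x₁ ⟨0, hn⟩ - y₁ ⟨0, hn⟩ with hP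
  set η : ℝ := min (1 / Q) (σ / (2 * (|P| + 1))) with hη
  have hη0 : 0 < η := lt_min (by positivity) (by positivity)
  have hηQ : η * Q ≤ 1 := by
    have := min_le_left (1 / Q) (σ / (2 * (|P| + 1)))
    rwa [← hη, le_div_iff₀ hQ0] at this
  have hη1 : η ≤ 1 := by nlinarith
  have hηP : η * (P + 1) < σ := by
    have h1 := min_le_right (1 / Q) (σ / (2 * (|P| + 1)))
    rw [← hη, le_div_iff₀ (by positivity)] at h1
    nlinarith [le_abs_self P, abs_nonneg P]
  set F := doublingFun ⟨0, hn⟩ U φ η with hF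
  have hstart : η < F x₁ y₁ t₁ := by
    have : F x₁ y₁ t₁ = σ - η * P := rfl
    rw [this]; linarith
  have hpen : ∀ x ∈ closedHalf n hn, ∀ y ∈ closedHalf n hn, ∀ t : ℝ, ‖x - y‖ ≤ r₀ →
      (‖x‖ ^ 2 + t ^ 2) / 2 - 3 ≤ ‖x‖ ^ 2 + t ^ 2 - x ⟨0, hn⟩ - y ⟨0, hn⟩ ∧
      -2 ≤ ‖x‖ ^ 2 + t ^ 2 - x ⟨0, hn⟩ - y ⟨0, hn⟩ := by
    intro x _ y _ t hxy
    have h1 := (abs_le.1 (euclidean_abs_apply_le x ⟨0, hn⟩)).2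
    have h2 := (abs_le.1 (euclidean_abs_apply_le (x - y) ⟨0, hn⟩)).1
    simp only [PiLp.sub_apply] at h2
    constructor <;> nlinarith [sq_nonneg (‖x‖ - 2), sq_nonneg (‖x‖ - 1), sq_nonneg t]
  have hbound : ∀ x ∈ closedHalf n hn, ∀ y ∈ closedHalf n hn, ∀ t, ‖x - y‖ ≤ r₀ →
      0 < F x y t → η * (‖x‖ ^ 2 + t ^ 2) ≤ Q := by
    intro x hx y hy t hxy hpos
    have h1 := hosc x hx y hy t
    have h2 := hφn _ (norm_nonneg (x - y))
    have h3 := mul_le_mul_of_nonneg_left (hpen x hx y hy t hxy).1 hη0.le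
    simp only [hF, doublingFun] at hpos
    linarith
  let S : Set (EuclideanSpace ℝ (Fin n) × EuclideanSpace ℝ (Fin n) × ℝ) :=
    ((closedHalf n hn) ×ˢ (closedHalf n hn) ×ˢ (univ : Set ℝ)) ∩
      ({p | ‖p.1 - p.2.1‖ ≤ r₀} ∩ {p | η * (‖p.1‖ ^ 2 + p.2.2 ^ 2) ≤ Q})
  have hScl : IsClosed S := by
    refine ((isClosed_closedHalf hn).prod ((isClosed_closedHalf hn).prod isClosed_univ)).inter
      (IsClosed.inter ?_ ?_)
    · exact isClosed_le (by fun_prop) continuous_const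
    · exact isClosed_le (by fun_prop) continuous_const
  have hSmem : ∀ x y t, (x, y, t) ∈ S ↔ (x ∈ closedHalf n hn ∧ y ∈ closedHalf n hn) ∧
      ‖x - y‖ ≤ r₀ ∧ η * (‖x‖ ^ 2 + t ^ 2) ≤ Q := by
    intro x y t
    simp [S, and_assoc]
  have hScomp : IsCompact S := by
    refine Metric.isCompact_of_isClosed_isBounded hScl ?_
    refine (Metric.isBounded_closedBall (x := 0) (r := Q / η + 2)).subset ?_
    rintro ⟨x, y, t⟩ hp
    obtain ⟨-, h1, h2⟩ := (hSmem x y t).1 hp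
    have h3 : ‖x‖ ^ 2 + t ^ 2 ≤ Q / η := by rw [le_div_iff₀ hη0]; linarith
    have hxb : ‖x‖ ≤ Q / η + 1 := by nlinarith [sq_nonneg (‖x‖ - 1), sq_nonneg t, norm_nonneg x]
    have htb : |t| ≤ Q / η + 1 := by
      nlinarith [sq_nonneg (|t| - 1), sq_abs t, abs_nonneg t, sq_nonneg ‖x‖]
    have hyb : ‖y‖ ≤ ‖x‖ + ‖x - y‖ := by
      have := norm_sub_le x (x - y)
      simpa using this
    rw [mem_closedBall_zero_iff, Prod.norm_def, Prod.norm_def]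
    simp only [sup_le_iff, Real.norm_eq_abs]
    exact ⟨by linarith, by linarith, by linarith⟩
  have hFc : ContinuousOn
      (fun p : EuclideanSpace ℝ (Fin n) × EuclideanSpace ℝ (Fin n) × ℝ => F p.1 p.2.1 p.2.2) S := by
    simp only [hF, doublingFun]
    refine ContinuousOn.sub (ContinuousOn.sub (ContinuousOn.sub ?_ ?_) ?_) (by fun_prop)
    · exact hcont.comp (f := fun p : EuclideanSpace ℝ (Fin n) × EuclideanSpace ℝ (Fin n) × ℝ =>
        (p.1, p.2.2)) (by fun_prop) fun p hp => ⟨hp.1.1, mem_univ _⟩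
    · exact hcont.comp (f := fun p : EuclideanSpace ℝ (Fin n) × EuclideanSpace ℝ (Fin n) × ℝ =>
        (p.2.1, p.2.2)) (by fun_prop) fun p hp => ⟨hp.1.2.1, mem_univ _⟩
    · exact hφc.comp (f := fun p : EuclideanSpace ℝ (Fin n) × EuclideanSpace ℝ (Fin n) × ℝ =>
        ‖p.1 - p.2.1‖) (by fun_prop) fun p _ => mem_Ici.2 (norm_nonneg _)
  have hp₁ : (x₁, y₁, t₁) ∈ S := (hSmem _ _ _).2 ⟨⟨hx₁, hy₁⟩, hnear.le,
    hbound _ hx₁ _ hy₁ _ hnear.le (hη0.trans hstart)⟩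
  obtain ⟨⟨x, y, t⟩, hp, hpmax⟩ := hScomp.exists_isMaxOn ⟨_, hp₁⟩ hFc
  obtain ⟨⟨hx, hy⟩, hxy, hxt⟩ := (hSmem x y t).1 hp
  have hFp : η < F x y t := hstart.trans_le (hpmax hp₁)
  have hmax : ∀ x' ∈ closedHalf n hn, ∀ y' ∈ closedHalf n hn, ∀ t', ‖x' - y'‖ ≤ r₀ →
      F x' y' t' ≤ F x y t := by
    intro x' hx' y' hy' t' h'
    by_contra! hgt
    have hS' : (x', y', t') ∈ S := (hSmem _ _ _).2 ⟨⟨hx', hy'⟩, h',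
      hbound _ hx' _ hy' _ h' (by linarith)⟩
    exact absurd (hpmax hS') (not_le.2 hgt)
  have hne : x ≠ y := by
    rintro rfl
    have h1 := (abs_le.1 (euclidean_abs_apply_le x ⟨0, hn⟩)).2
    have h2 : -1 ≤ ‖x‖ ^ 2 + t ^ 2 - x ⟨0, hn⟩ - x ⟨0, hn⟩ := by
      nlinarith [sq_nonneg (‖x‖ - 1), sq_nonneg t]
    have h3 := mul_le_mul_of_nonneg_left h2 hη0.le
    simp only [hF, doublingFun, sub_self, norm_zero, hφ0] at hFp
    linarith
  have hrlt : ‖x - y‖ < r₀ := by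
    refine lt_of_le_of_ne hxy fun h => ?_
    have h1 := hosc x hx y hy t
    have h3 := mul_le_mul_of_nonneg_left (hpen x hx y hy t hxy).2 hη0.le
    simp only [hF, doublingFun, h] at hFp
    linarith
  have hsmall : (η * ‖x‖) ^ 2 + (η * t) ^ 2 ≤ 1 := by
    calc (η * ‖x‖) ^ 2 + (η * t) ^ 2 = η * (η * (‖x‖ ^ 2 + t ^ 2)) := by ring
      _ ≤ η * Q := by gcongr
      _ ≤ 1 := hηQ
  have hηx : η * ‖x‖ ≤ 1 := by
    refine (abs_le.1 ((sq_le_one_iff_abs_le_one _).1 ?_)).2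
    linarith [sq_nonneg (η * t)]
  have hηt : |η * t| ≤ 1 := by
    rw [← sq_le_one_iff_abs_le_one]; linarith [sq_nonneg (η * ‖x‖)]
  exact not_doublingFun_max hC hN hreg heq hφ hd hd1 hη0 hη1 hηx hηt hx hy hne hrlt hmax

end Lipschitz

section NeumannTransform

variable {n : ℕ}

/-- The bounded weight `1 - exp (-xᵢ)`, vanishing with unit normal derivative at `xᵢ = 0`. -/
noncomputable def boundaryWeight (i : Fin n) (x : EuclideanSpace ℝ (Fin n)) : ℝ :=
  1 - Real.exp (-x i)

/-- The transform `z + w (z ^ q - 1)` with `z = f + w`, where `w` is the boundary weight. It turns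
the flux condition `-∂f = f ^ q` into a homogeneous Neumann condition. -/
noncomputable def neumannTransform (i : Fin n) (q : ℝ) (f : EuclideanSpace ℝ (Fin n) → ℝ)
    (x : EuclideanSpace ℝ (Fin n)) : ℝ :=
  (f x + boundaryWeight i x) + boundaryWeight i x * ((f x + boundaryWeight i x) ^ q - 1)

lemma contDiff_boundaryWeight (i : Fin n) : ContDiff ℝ 2 (boundaryWeight i) := by
  unfold boundaryWeight
  fun_prop

lemma boundaryWeight_nonneg {i : Fin n} {x : EuclideanSpace ℝ (Fin n)} (hx : 0 ≤ x i) :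
    0 ≤ boundaryWeight i x :=
  sub_nonneg.2 (Real.exp_le_one_iff.2 (by linarith))

lemma boundaryWeight_le_one (i : Fin n) (x : EuclideanSpace ℝ (Fin n)) :
    boundaryWeight i x ≤ 1 :=
  sub_le_self _ (Real.exp_pos _).le

lemma hasDerivAt_exp_neg_line (i : Fin n) (x v : EuclideanSpace ℝ (Fin n)) (s : ℝ) :
    HasDerivAt (fun s : ℝ => Real.exp (-(x + s • v) i))
      (-(Real.exp (-(x + s • v) i) * v i)) s :=
  ((hasDerivAt_apply_line x v i s).fun_neg.exp).congr_deriv (by ring)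

lemma hasDerivAt_boundaryWeight_line (i : Fin n) (x v : EuclideanSpace ℝ (Fin n)) (s : ℝ) :
    HasDerivAt (fun s : ℝ => boundaryWeight i (x + s • v))
      (Real.exp (-(x + s • v) i) * v i) s :=
  ((hasDerivAt_exp_neg_line i x v s).const_sub 1).congr_deriv (by ring)

lemma ContDiffAt.neumannTransform {i : Fin n} {q : ℝ} {f : EuclideanSpace ℝ (Fin n) → ℝ}
    {x : EuclideanSpace ℝ (Fin n)} (hf : ContDiffAt ℝ 2 f x)
    (hz : f x + boundaryWeight i x ≠ 0) : ContDiffAt ℝ 2 (neumannTransform i q f) x := by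
  have hw := (contDiff_boundaryWeight i).contDiffAt (x := x)
  exact (hf.add hw).add (hw.mul (((hf.add hw).rpow_const_of_ne hz).sub contDiffAt_const))

lemma HasDerivWithinAt.neumannTransform_line {i : Fin n} {q : ℝ}
    {f : EuclideanSpace ℝ (Fin n) → ℝ} {x v : EuclideanSpace ℝ (Fin n)} {s c : ℝ} {J : Set ℝ}
    (hf : HasDerivWithinAt (fun s : ℝ => f (x + s • v)) c J s)
    (hz : f (x + s • v) + boundaryWeight i (x + s • v) ≠ 0) :
    HasDerivWithinAt (fun s : ℝ => _root_.neumannTransform i q f (x + s • v))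
      ((c + Real.exp (-(x + s • v) i) * v i) +
        (Real.exp (-(x + s • v) i) * v i *
          ((f (x + s • v) + boundaryWeight i (x + s • v)) ^ q - 1) +
        boundaryWeight i (x + s • v) * ((c + Real.exp (-(x + s • v) i) * v i) * q *
          (f (x + s • v) + boundaryWeight i (x + s • v)) ^ (q - 1)))) J s := by
  have hw := (hasDerivAt_boundaryWeight_line i x v s).hasDerivWithinAt (s := J)
  exact (hf.add hw).add (hw.mul (((hf.add hw).rpow_const (p := q) (Or.inl hz)).sub_const 1))

/-- The Neumann transform satisfies the homogeneous Neumann condition. -/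
lemma hasDerivWithinAt_neumannTransform_boundary {i : Fin n} {q : ℝ}
    {f : EuclideanSpace ℝ (Fin n) → ℝ} {x : EuclideanSpace ℝ (Fin n)} (hx : x i = 0)
    (hpos : 0 < f x) (hf : HasDerivWithinAt
      (fun s : ℝ => f (x + s • EuclideanSpace.single i (1 : ℝ))) (-(f x ^ q)) (Ici 0) 0) :
    HasDerivWithinAt (fun s : ℝ =>
      neumannTransform i q f (x + s • EuclideanSpace.single i (1 : ℝ))) 0 (Ici 0) 0 := by
  have hw : boundaryWeight i x = 0 := by simp [boundaryWeight, hx]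
  refine (hf.neumannTransform_line (i := i) (q := q) ?_).congr_deriv ?_
  · simp only [zero_smul, add_zero, hw]; exact hpos.ne'
  · simp only [zero_smul, add_zero, hw]
    simp [hx]

lemma fderiv_neumannTransform_apply {i : Fin n} {q : ℝ} {f : EuclideanSpace ℝ (Fin n) → ℝ}
    {x : EuclideanSpace ℝ (Fin n)} (hf : ContDiffAt ℝ 2 f x)
    (hz : f x + boundaryWeight i x ≠ 0) (v : EuclideanSpace ℝ (Fin n)) :
    fderiv ℝ (neumannTransform i q f) x v =
      (1 + boundaryWeight i x * q * (f x + boundaryWeight i x) ^ (q - 1)) *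
        (fderiv ℝ f x v + Real.exp (-x i) * v i) +
      Real.exp (-x i) * v i * ((f x + boundaryWeight i x) ^ q - 1) := by
  have h1 := (hf.neumannTransform (q := q) hz).eventually_hasDerivAt_line v |>.self_of_nhds
  have h2 := ((hf.eventually_hasDerivAt_line v).self_of_nhds.hasDerivWithinAt
    (s := univ)).neumannTransform_line (i := i) (q := q) (by simpa using hz)
  rw [hasDerivWithinAt_univ] at h2
  have h := h1.unique h2
  simp only [zero_smul, add_zero] at h
  rw [h]; ring

lemma fderiv_fderiv_neumannTransform_apply {i : Fin n} {q : ℝ}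
    {f : EuclideanSpace ℝ (Fin n) → ℝ} {x : EuclideanSpace ℝ (Fin n)} (hf : ContDiffAt ℝ 2 f x)
    (hz : f x + boundaryWeight i x ≠ 0) (v : EuclideanSpace ℝ (Fin n)) :
    fderiv ℝ (fderiv ℝ (neumannTransform i q f)) x v v =
      (1 + boundaryWeight i x * q * (f x + boundaryWeight i x) ^ (q - 1)) *
        (fderiv ℝ (fderiv ℝ f) x v v - Real.exp (-x i) * v i ^ 2) -
      Real.exp (-x i) * v i ^ 2 * ((f x + boundaryWeight i x) ^ q - 1) +
      2 * (Real.exp (-x i) * v i) * q * (f x + boundaryWeight i x) ^ (q - 1) *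
        (fderiv ℝ f x v + Real.exp (-x i) * v i) +
      boundaryWeight i x * (f x + boundaryWeight i x) ^ (q - 2) * (q * (q - 1)) *
        (fderiv ℝ f x v + Real.exp (-x i) * v i) ^ 2 := by
  have hne : ∀ᶠ s : ℝ in nhds 0, f (x + s • v) + boundaryWeight i (x + s • v) ≠ 0 :=
    (tendsto_line x v).eventually
      ((hf.continuousAt.add (contDiff_boundaryWeight i).continuous.continuousAt).eventually_ne hz)
  have hd1 : ∀ᶠ s : ℝ in nhds 0, HasDerivAt
      (fun s : ℝ => neumannTransform i q f (x + s • v))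
      ((fderiv ℝ f (x + s • v) v + Real.exp (-(x + s • v) i) * v i) +
        (Real.exp (-(x + s • v) i) * v i *
          ((f (x + s • v) + boundaryWeight i (x + s • v)) ^ q - 1) +
        boundaryWeight i (x + s • v) *
          ((fderiv ℝ f (x + s • v) v + Real.exp (-(x + s • v) i) * v i) * q *
          (f (x + s • v) + boundaryWeight i (x + s • v)) ^ (q - 1)))) s := by
    filter_upwards [hf.eventually_hasDerivAt_line v, hne] with s hs hs'
    exact hasDerivWithinAt_univ.1
      ((hs.hasDerivWithinAt (s := univ)).neumannTransform_line (i := i) (q := q) hs')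
  have hf0 := (hf.eventually_hasDerivAt_line v).self_of_nhds
  have hf1 := hf.hasDerivAt_fderiv_line v
  have hw := hasDerivAt_boundaryWeight_line i x v 0
  have hk := (hasDerivAt_exp_neg_line i x v 0).mul_const (v i)
  have hz0 : f (x + (0 : ℝ) • v) + boundaryWeight i (x + (0 : ℝ) • v) ≠ 0 := by simpa using hz
  have hp := (hf0.add hw).rpow_const (p := q) (Or.inl hz0)
  have hp1 := (hf0.add hw).rpow_const (p := q - 1) (Or.inl hz0)
  have hd2 := (hf1.add hk).add ((hk.mul (hp.sub_const 1)).add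
    (hw.mul (((hf1.add hk).mul_const q).mul hp1)))
  rw [(hf.neumannTransform (q := q) hz).fderiv_fderiv_eq_of_line hd1 hd2]
  simp only [Pi.add_apply, Pi.mul_apply, zero_smul, add_zero]
  rw [show q - 1 - 1 = q - 2 by ring]
  ring

/-- Elementary bounds on the coefficients produced by the Neumann transform. -/
lemma neumannTransform_coeff_bound {q B z w k δ P ζ p : ℝ} (hq : 1 < q) (hB : 1 ≤ B)
    (hz : 0 ≤ z ^ q) (hzB : z ^ q ≤ B) (hz1 : 0 ≤ z ^ (q - 1)) (hz1B : z ^ (q - 1) ≤ B)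
    (hz2 : 0 ≤ w * z ^ (q - 2)) (hz2B : w * z ^ (q - 2) ≤ B)
    (hw : 0 ≤ w) (hw1 : w ≤ 1) (hk : 0 ≤ k) (hk1 : k ≤ 1) (hδ : |δ| ≤ 1) (hp : |p| ≤ P)
    (hpe : p = (1 + w * q * z ^ (q - 1)) * ζ + k * δ * (z ^ q - 1)) :
    |ζ| ≤ P + B ∧
    |(1 + w * q * z ^ (q - 1)) * (k * δ ^ 2) + k * δ ^ 2 * (z ^ q - 1)
      - 2 * (k * δ) * q * z ^ (q - 1) * ζ - w * z ^ (q - 2) * (q * (q - 1)) * ζ ^ 2| ≤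
      (1 + 2 * q * B + B + (q * B + q ^ 2 * B) * (2 + 2 * B ^ 2)) * (1 + P ^ 2) := by
  have hq0 : 0 < q := by linarith
  have hkδ : |k * δ| ≤ 1 := by
    rw [abs_mul, abs_of_nonneg hk]; exact mul_le_one₀ hk1 (abs_nonneg _) hδ
  have hzq : |z ^ q - 1| ≤ B := by rw [abs_le]; constructor <;> linarith
  have hA : 0 ≤ w * q * z ^ (q - 1) := by positivity
  have hAB : w * q * z ^ (q - 1) ≤ q * B := by
    calc w * q * z ^ (q - 1) ≤ 1 * q * B := by gcongr
      _ = q * B := by ring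
  have hζ : |ζ| ≤ P + B := by
    have h1 : (1 + w * q * z ^ (q - 1)) * ζ = p - k * δ * (z ^ q - 1) := by rw [hpe]; ring
    have h2 : (1 + w * q * z ^ (q - 1)) * |ζ| ≤ P + B := by
      rw [← abs_of_nonneg (show 0 ≤ 1 + w * q * z ^ (q - 1) by linarith), ← abs_mul, h1]
      refine (abs_sub _ _).trans (add_le_add hp ?_)
      rw [abs_mul]
      calc |k * δ| * |z ^ q - 1| ≤ 1 * B := by gcongr
        _ = B := one_mul B
    nlinarith [abs_nonneg ζ]
  refine ⟨hζ, ?_⟩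
  have hζ2 : ζ ^ 2 ≤ 2 * P ^ 2 + 2 * B ^ 2 := by
    have : ζ ^ 2 ≤ (P + B) ^ 2 := by
      rw [← sq_abs ζ]; gcongr
    nlinarith [sq_nonneg (P - B)]
  have hδ2 : k * δ ^ 2 ≤ 1 := by
    have : δ ^ 2 ≤ 1 := by rwa [sq_le_one_iff_abs_le_one]
    exact mul_le_one₀ hk1 (sq_nonneg _) this
  have hδ0 : 0 ≤ k * δ ^ 2 := by positivity
  have t1 : |(1 + w * q * z ^ (q - 1)) * (k * δ ^ 2)| ≤ 1 + q * B := by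
    rw [abs_of_nonneg (by positivity)]
    calc _ ≤ (1 + q * B) * 1 := by gcongr
      _ = _ := mul_one _
  have t2 : |k * δ ^ 2 * (z ^ q - 1)| ≤ B := by
    rw [abs_mul, abs_of_nonneg hδ0]
    calc _ ≤ 1 * B := by gcongr
      _ = _ := one_mul _
  have t3 : |2 * (k * δ) * q * z ^ (q - 1) * ζ| ≤ q * B * (1 + ζ ^ 2) := by
    have h : |2 * (k * δ) * q * z ^ (q - 1) * ζ| = |k * δ| * (q * (z ^ (q - 1) * (2 * |ζ|))) := by
      simp only [abs_mul, abs_of_nonneg hz1, abs_of_pos hq0, abs_two]; ring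
    rw [h]
    have h2 : 2 * |ζ| ≤ 1 + ζ ^ 2 := by nlinarith [sq_nonneg (|ζ| - 1), sq_abs ζ]
    calc _ ≤ 1 * (q * (B * (1 + ζ ^ 2))) := by gcongr
      _ = _ := by ring
  have t4 : |w * z ^ (q - 2) * (q * (q - 1)) * ζ ^ 2| ≤ q ^ 2 * B * ζ ^ 2 := by
    have hq1 : 0 ≤ q - 1 := by linarith
    rw [abs_of_nonneg (by positivity)]
    calc _ ≤ B * (q * q) * ζ ^ 2 := by gcongr; linarith
      _ = _ := by ring
  have hsum := ((abs_sub _ _).trans (add_le_add ((abs_sub _ _).trans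
    (add_le_add ((abs_add_le _ _).trans (add_le_add t1 t2)) t3)) t4))
  refine hsum.trans ?_
  have h5 : (q * B + q ^ 2 * B) * ζ ^ 2 ≤ (q * B + q ^ 2 * B) * (2 * P ^ 2 + 2 * B ^ 2) := by
    gcongr
  have h6 : 0 ≤ (1 + 2 * q * B + B) * P ^ 2 := by positivity
  have h7 : 0 ≤ (q * B + q ^ 2 * B) * (2 + 2 * B ^ 2 * P ^ 2) := by positivity
  nlinarith

end NeumannTransform

section GradientBound

variable {n : ℕ} {hn : 0 < n} {q : ℝ} {u : EuclideanSpace ℝ (Fin n) × ℝ → ℝ}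

lemma IsHalfSpaceSol.contDiffAt (hu : IsHalfSpaceSol n hn q u) {x : EuclideanSpace ℝ (Fin n)}
    (hx : x ∈ openHalf n hn) (t : ℝ) : ContDiffAt ℝ 2 (fun y => u (y, t)) x :=
  (hu.2.2.2.1 t).contDiffAt ((isOpen_openHalf hn).mem_nhds hx)

lemma IsHalfSpaceSol.hasFDerivWithinAt (hu : IsHalfSpaceSol n hn q u)
    {x : EuclideanSpace ℝ (Fin n)} (hx : x ∈ closedHalf n hn) (t : ℝ) :
    HasFDerivWithinAt (fun y => u (y, t))
      (fderivWithin ℝ (fun y => u (y, t)) (closedHalf n hn) x) (closedHalf n hn) x :=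
  ((hu.2.1 t).differentiableOn (by simp) x hx).hasFDerivWithinAt

lemma IsHalfSpaceSol.hasDerivWithinAt_boundary (hu : IsHalfSpaceSol n hn q u)
    {x : EuclideanSpace ℝ (Fin n)} (hx : x ⟨0, hn⟩ = 0) (t : ℝ) :
    HasDerivWithinAt (fun s : ℝ => u (x + s • EuclideanSpace.single ⟨0, hn⟩ (1 : ℝ), t))
      (-(u (x, t) ^ q)) (Ici 0) 0 := by
  have hxc : x ∈ closedHalf n hn := mem_closedHalf.2 hx.ge
  rw [← hu.2.2.2.2.2.2.1 x hx t, neg_neg]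
  refine HasFDerivWithinAt.comp_hasDerivWithinAt (l := fun y => u (y, t))
    (f := fun s : ℝ => x + s • EuclideanSpace.single ⟨0, hn⟩ (1 : ℝ)) (t := closedHalf n hn)
    0 ?_ (hasDerivAt_line x _ 0).hasDerivWithinAt
    fun s hs => add_smul_single_mem_closedHalf hn hxc hs
  simpa using hu.hasFDerivWithinAt hxc t

lemma norm_le_of_forall_single_le {p : EuclideanSpace ℝ (Fin n) →L[ℝ] ℝ} {m : ℝ} (hm : 0 ≤ m)
    (h : ∀ j, |p (EuclideanSpace.single j 1)| ≤ m) : ‖p‖ ≤ n * m := by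
  refine p.opNorm_le_bound (by positivity) fun v => ?_
  have hv : p v = ∑ j, v j * p (EuclideanSpace.single j 1) := by
    conv_lhs => rw [← euclidean_sum_single v]
    simp only [map_sum, map_smul, smul_eq_mul]
  rw [hv]
  calc ‖∑ j, v j * p (EuclideanSpace.single j 1)‖
      ≤ ∑ j : Fin n, m * ‖v‖ := norm_sum_le_of_le _ fun j _ => by
        rw [norm_mul, mul_comm, Real.norm_eq_abs, Real.norm_eq_abs]
        gcongr
        · exact h j
        · exact euclidean_abs_apply_le v j
    _ = n * m * ‖v‖ := by simp; ring

lemma abs_single_apply_le_one (i j : Fin n) :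
    |(EuclideanSpace.single j (1 : ℝ) : EuclideanSpace ℝ (Fin n)) i| ≤ 1 := by
  simpa using euclidean_abs_apply_le (EuclideanSpace.single j (1 : ℝ)) i

/-- A bounded positive solution of the half-space problem has bounded spatial gradient. -/
theorem IsHalfSpaceSol.exists_gradient_bound (hq : 1 < q) (hu : IsHalfSpaceSol n hn q u) {M : ℝ}
    (hM : ∀ x ∈ closedHalf n hn, ∀ t : ℝ, u (x, t) ≤ M) :
    ∃ G : ℝ, ∀ x ∈ closedHalf n hn, ∀ t : ℝ,
      ‖fderivWithin ℝ (fun y => u (y, t)) (closedHalf n hn) x‖ ≤ G := by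
  have hpos := hu.2.2.2.2.2.2.2
  have hM0 : 0 < M := by
    have h0 : (0 : EuclideanSpace ℝ (Fin n)) ∈ closedHalf n hn := mem_closedHalf.2 (by simp)
    exact (hpos 0 h0 0).trans_le (hM 0 h0 0)
  have hq0 : 0 < q := by linarith
  set i : Fin n := ⟨0, hn⟩ with hi
  set w : EuclideanSpace ℝ (Fin n) → ℝ := boundaryWeight i with hw
  set B : ℝ := (M + 1) ^ q with hB
  have hB1 : 1 ≤ B := Real.one_le_rpow (by linarith) hq0.le
  have hwn : ∀ x ∈ closedHalf n hn, 0 ≤ w x := fun x hx =>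
    boundaryWeight_nonneg (mem_closedHalf.1 hx)
  have hz0 : ∀ x ∈ closedHalf n hn, ∀ t, 0 < u (x, t) + w x := fun x hx t =>
    add_pos_of_pos_of_nonneg (hpos x hx t) (hwn x hx)
  have hzM : ∀ x ∈ closedHalf n hn, ∀ t, u (x, t) + w x ≤ M + 1 := fun x hx t =>
    add_le_add (hM x hx t) (boundaryWeight_le_one i x)
  have hzB : ∀ x ∈ closedHalf n hn, ∀ t, (u (x, t) + w x) ^ q ≤ B := fun x hx t =>
    Real.rpow_le_rpow (hz0 x hx t).le (hzM x hx t) hq0.le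
  have hz1B : ∀ x ∈ closedHalf n hn, ∀ t, (u (x, t) + w x) ^ (q - 1) ≤ B := fun x hx t =>
    (Real.rpow_le_rpow (hz0 x hx t).le (hzM x hx t) (by linarith)).trans
      (Real.rpow_le_rpow_of_exponent_le (by linarith) (by linarith))
  have hz2B : ∀ x ∈ closedHalf n hn, ∀ t, w x * (u (x, t) + w x) ^ (q - 2) ≤ B := fun x hx t =>
    calc w x * (u (x, t) + w x) ^ (q - 2)
        ≤ (u (x, t) + w x) ^ (1 : ℝ) * (u (x, t) + w x) ^ (q - 2) := by
          rw [Real.rpow_one]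
          have := Real.rpow_nonneg (hz0 x hx t).le (q - 2)
          gcongr
          linarith [hpos x hx t]
      _ = (u (x, t) + w x) ^ (q - 1) := by
          rw [← Real.rpow_add (hz0 x hx t)]; congr 1; ring
      _ ≤ B := hz1B x hx t
  set U : EuclideanSpace ℝ (Fin n) × ℝ → ℝ :=
    fun p => neumannTransform i q (fun y => u (y, p.2)) p.1 with hU
  set C₁ : ℝ := 1 + 2 * q * B + B + (q * B + q ^ 2 * B) * (2 + 2 * B ^ 2) with hC₁
  have hC₁0 : 0 ≤ C₁ := by positivity
  have hcoeff : ∀ x ∈ openHalf n hn, ∀ t, ∀ j : Fin n, _ := fun x hx t j =>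
    have hxc := openHalf_subset_closedHalf hn hx
    neumannTransform_coeff_bound (P := ‖fderiv ℝ (fun y => U (y, t)) x‖) hq hB1
      (Real.rpow_nonneg (hz0 x hxc t).le q) (hzB x hxc t)
      (Real.rpow_nonneg (hz0 x hxc t).le (q - 1)) (hz1B x hxc t)
      (mul_nonneg (hwn x hxc) (Real.rpow_nonneg (hz0 x hxc t).le (q - 2))) (hz2B x hxc t)
      (hwn x hxc) (boundaryWeight_le_one i x) (Real.exp_pos (-x i)).le
      (Real.exp_le_one_iff.2 (by have := mem_closedHalf.1 hxc; linarith))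
      (abs_single_apply_le_one i j)
      (by simpa using (fderiv ℝ (fun y => U (y, t)) x).le_opNorm (EuclideanSpace.single j 1))
      (fderiv_neumannTransform_apply (hu.contDiffAt hx t) (hz0 x hxc t).ne' _)
  have hreg : ∀ x ∈ openHalf n hn, ∀ t, ContDiffAt ℝ 2 (fun y => U (y, t)) x := fun x hx t =>
    (hu.contDiffAt hx t).neumannTransform (hz0 x (openHalf_subset_closedHalf hn hx) t).ne'
  have hcont : ContinuousOn U (closedHalf n hn ×ˢ (univ : Set ℝ)) := by
    have hwc : Continuous fun p : EuclideanSpace ℝ (Fin n) × ℝ => w p.1 :=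
      (contDiff_boundaryWeight i).continuous.comp continuous_fst
    have hzc := hu.1.add hwc.continuousOn
    exact hzc.add (hwc.continuousOn.mul ((hzc.rpow_const
      fun p hp => Or.inl (hz0 p.1 hp.1 p.2).ne').sub continuousOn_const))
  have hUle : ∀ x ∈ closedHalf n hn, ∀ t, -1 ≤ U (x, t) ∧ U (x, t) ≤ M + 1 + B := by
    intro x hx t
    have h1 := hwn x hx
    have h2 : w x ≤ 1 := boundaryWeight_le_one i x
    have h3 := hzB x hx t
    have h4 := Real.rpow_nonneg (hz0 x hx t).le q
    have h5 := hz0 x hx t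
    have h6 := hzM x hx t
    have h7 : U (x, t) = (u (x, t) + w x) + w x * ((u (x, t) + w x) ^ q - 1) := rfl
    have h8 := mul_nonneg h1 h4
    have h9 : w x * (u (x, t) + w x) ^ q ≤ 1 * B := by gcongr
    rw [h7]
    constructor <;> linarith
  have heq : ∀ x ∈ openHalf n hn, ∀ t, ∃ τ, HasDerivAt (fun s => U (x, s)) τ t ∧
      |τ - lap (fun y => U (y, t)) x| ≤
        n * C₁ * (1 + ‖fderiv ℝ (fun y => U (y, t)) x‖ ^ 2) := by
    intro x hx t
    have hxc := openHalf_subset_closedHalf hn hx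
    have hut : HasDerivAt (fun s => u (x, s)) (lap (fun y => u (y, t)) x) t := by
      rw [← hu.2.2.2.2.2.1 x hx t]
      exact ((hu.2.2.2.2.1 x hx).differentiable (by simp) t).hasDerivAt
    have hzt := hut.add_const (w x)
    have hUt := hzt.add ((((hzt.rpow_const (p := q) (Or.inl (hz0 x hxc t).ne')).sub_const
      1)).const_mul (w x))
    refine ⟨_, hUt, ?_⟩
    rw [lap_eq_sum (hreg x hx t), lap_eq_sum (hu.contDiffAt hx t)]
    have hfac : ∀ S : ℝ, S + w x * (S * q * (u (x, t) + w x) ^ (q - 1)) =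
        (1 + w x * q * (u (x, t) + w x) ^ (q - 1)) * S := fun S => by ring
    rw [hfac, Finset.mul_sum, ← Finset.sum_sub_distrib]
    refine (Finset.abs_sum_le_sum_abs _ _).trans ?_
    calc _ ≤ ∑ j : Fin n, C₁ * (1 + ‖fderiv ℝ (fun y => U (y, t)) x‖ ^ 2) := by
          refine Finset.sum_le_sum fun j _ => le_trans (le_of_eq ?_) (hcoeff x hx t j).2
          rw [fderiv_fderiv_neumannTransform_apply (hu.contDiffAt hx t) (hz0 x hxc t).ne']
          congr 1
          ring
      _ = _ := by simp; ring
  obtain ⟨L, hL⟩ := exists_lipschitz_of_neumann (hn := hn) (U := U) (C := n * C₁)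
    (K := M + 1 + B + 1) (by positivity) (by linarith) hcont
    (fun x hx y hy t => by linarith [(hUle x hx t).2, (hUle y hy t).1])
    (fun x hx t => hasDerivWithinAt_neumannTransform_boundary (i := i) (q := q)
      (f := fun y => u (y, t)) hx (hpos x (mem_closedHalf.2 hx.ge) t)
      (hu.hasDerivWithinAt_boundary hx t))
    hreg heq
  have hgradU : ∀ x ∈ openHalf n hn, ∀ t, ‖fderiv ℝ (fun y => U (y, t)) x‖ ≤ |L| := by
    intro x hx t
    refine norm_fderiv_le_of_lip' ℝ (abs_nonneg L) ?_
    filter_upwards [(isOpen_openHalf hn).mem_nhds hx] with y hy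
    have hxc := openHalf_subset_closedHalf hn hx
    have hyc := openHalf_subset_closedHalf hn hy
    have h1 := hL x hxc y hyc t
    have h2 := hL y hyc x hxc t
    have h3 : L * ‖y - x‖ ≤ |L| * ‖y - x‖ := by gcongr; exact le_abs_self L
    rw [norm_sub_rev x y] at h1
    rw [Real.norm_eq_abs, abs_le]
    constructor <;> linarith
  have hopen : ∀ x ∈ openHalf n hn, ∀ t,
      ‖fderivWithin ℝ (fun y => u (y, t)) (closedHalf n hn) x‖ ≤ n * (|L| + B + 1) := by
    intro x hx t
    have hxc := openHalf_subset_closedHalf hn hx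
    rw [fderivWithin_of_mem_nhds (Filter.mem_of_superset ((isOpen_openHalf hn).mem_nhds hx)
      (openHalf_subset_closedHalf hn))]
    refine norm_le_of_forall_single_le (by positivity) fun j => ?_
    have h1 := abs_le.1 (hcoeff x hx t j).1
    have h2 := hgradU x hx t
    have h3 : |Real.exp (-x i) * (EuclideanSpace.single j (1 : ℝ) :
        EuclideanSpace ℝ (Fin n)) i| ≤ 1 := by
      rw [abs_mul, abs_of_pos (Real.exp_pos _)]
      exact mul_le_one₀ (Real.exp_le_one_iff.2 (by have := mem_closedHalf.1 hxc; linarith))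
        (abs_nonneg _) (abs_single_apply_le_one i j)
    have h4 := abs_le.1 h3
    rw [abs_le]
    constructor <;> linarith [h1.1, h1.2, h4.1, h4.2]
  refine ⟨n * (|L| + B + 1), fun x hx t => ?_⟩
  refine ContinuousWithinAt.closure_le (s := openHalf n hn)
    (f := fun x => ‖fderivWithin ℝ (fun y => u (y, t)) (closedHalf n hn) x‖)
    (closedHalf_subset_closure_openHalf hn hx) ?_ continuousWithinAt_const
    fun y hy => hopen y hy t
  exact ((hu.2.2.1 t x hx).mono (openHalf_subset_closedHalf hn)).norm

end GradientBound

section Scaling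

variable {n : ℕ} {hn : 0 < n} {q : ℝ} {u : EuclideanSpace ℝ (Fin n) × ℝ → ℝ} {c l : ℝ}

lemma lap_const_mul_comp_smul (f : EuclideanSpace ℝ (Fin n) → ℝ) (c l : ℝ)
    (x : EuclideanSpace ℝ (Fin n)) :
    lap (fun y => c * f (l • y)) x = c * l ^ 2 * lap f (l • x) := by
  have h (g : EuclideanSpace ℝ (Fin n) → ℝ) (a : ℝ) (y v : EuclideanSpace ℝ (Fin n)) :
      fderiv ℝ (fun y => a * g (l • y)) y v = a * l * fderiv ℝ g (l • y) v := by
    have h1 := congrFun (fderiv_const_smul_field (𝕜 := ℝ) a (f := fun y => g (l • y))) y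
    have h2 := fderiv_comp_smul (𝕜 := ℝ) (f := g) (x := y) l
    simp only [Pi.smul_def, smul_eq_mul] at h1
    rw [h1, h2]
    simp [mul_assoc]
  unfold lap
  rw [Finset.mul_sum]
  refine Finset.sum_congr rfl fun j _ => ?_
  simp only [h]
  rw [h (fun y => fderiv ℝ f y (EuclideanSpace.single j 1))]
  ring

lemma smul_mem_openHalf (hl : 0 < l) {x : EuclideanSpace ℝ (Fin n)} (hx : x ∈ openHalf n hn) :
    l • x ∈ openHalf n hn :=
  mem_openHalf.2 (by simpa using mul_pos hl (mem_openHalf.1 hx))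

lemma smul_mem_closedHalf (hl : 0 ≤ l) {x : EuclideanSpace ℝ (Fin n)}
    (hx : x ∈ closedHalf n hn) : l • x ∈ closedHalf n hn :=
  mem_closedHalf.2 (by simpa using mul_nonneg hl (mem_closedHalf.1 hx))

lemma IsHalfSpaceSol.fderivWithin_scale (hu : IsHalfSpaceSol n hn q u) (hl : 0 ≤ l) (c : ℝ)
    {x : EuclideanSpace ℝ (Fin n)} (hx : x ∈ closedHalf n hn) (t : ℝ) :
    fderivWithin ℝ (fun y => c * u (l • y, t)) (closedHalf n hn) x =
      (c * l) • fderivWithin ℝ (fun y => u (y, t)) (closedHalf n hn) (l • x) := by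
  refine HasFDerivWithinAt.fderivWithin ?_ (uniqueDiffOn_closedHalf hn x hx)
  have h1 := (hu.hasFDerivWithinAt (smul_mem_closedHalf hl hx) t).comp x
    ((hasFDerivAt_id x).const_smul l).hasFDerivWithinAt
    (fun y hy => smul_mem_closedHalf (hn := hn) hl hy)
  refine (h1.const_mul c).congr_fderiv ?_
  ext v
  simp [mul_assoc]

/-- The parabolic scaling that preserves the half-space problem. -/
lemma IsHalfSpaceSol.scale (hu : IsHalfSpaceSol n hn q u) (hc : 0 < c) (hl : 0 < l)
    (hcl : c * l = c ^ q) :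
    IsHalfSpaceSol n hn q fun p => c * u (l • p.1, l ^ 2 * p.2) := by
  have hmapc : MapsTo (fun x : EuclideanSpace ℝ (Fin n) => l • x) (closedHalf n hn)
      (closedHalf n hn) := fun x hx => smul_mem_closedHalf hl.le hx
  have hmapo : MapsTo (fun x : EuclideanSpace ℝ (Fin n) => l • x) (openHalf n hn)
      (openHalf n hn) := fun x hx => smul_mem_openHalf hl hx
  have hpos := hu.2.2.2.2.2.2.2
  refine ⟨?_, fun t => ?_, fun t => ?_, fun t => ?_, fun x hx => ?_, fun x hx t => ?_,
    fun x hx t => ?_, fun x hx t => ?_⟩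
  · refine continuousOn_const.mul (hu.1.comp (f := fun p : EuclideanSpace ℝ (Fin n) × ℝ =>
      (l • p.1, l ^ 2 * p.2)) (by fun_prop) fun p hp => ⟨hmapc hp.1, mem_univ _⟩)
  · exact contDiffOn_const.mul ((hu.2.1 (l ^ 2 * t)).comp (by fun_prop) hmapc)
  · refine ContinuousOn.congr (f := fun x => (c * l) • fderivWithin ℝ
      (fun y => u (y, l ^ 2 * t)) (closedHalf n hn) (l • x)) ?_
      fun x hx => hu.fderivWithin_scale hl.le c hx (l ^ 2 * t)
    exact ((hu.2.2.1 (l ^ 2 * t)).comp (by fun_prop) hmapc).const_smul (c * l)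
  · exact contDiffOn_const.mul ((hu.2.2.2.1 (l ^ 2 * t)).comp (by fun_prop) hmapo)
  · exact contDiff_const.mul ((hu.2.2.2.2.1 _ (hmapo hx)).comp
      (by fun_prop : ContDiff ℝ 1 fun s : ℝ => l ^ 2 * s))
  · have h1 := (((hu.2.2.2.2.1 _ (hmapo hx)).differentiable (by simp)
      (l ^ 2 * t)).hasDerivAt.comp t ((hasDerivAt_id t).const_mul (l ^ 2))).const_mul c
    have h2 := h1.deriv
    simp only [Function.comp_def] at h2
    rw [h2, hu.2.2.2.2.2.1 _ (hmapo hx)]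
    exact Eq.trans (by ring)
      (lap_const_mul_comp_smul (fun y => u (y, l ^ 2 * t)) c l x).symm
  · have hxc : x ∈ closedHalf n hn := mem_closedHalf.2 hx.ge
    have h1 := hu.2.2.2.2.2.2.1 (l • x) (by simp [hx]) (l ^ 2 * t)
    have h2 := congrArg (fun p => p (EuclideanSpace.single (⟨0, hn⟩ : Fin n) (1 : ℝ)))
      (hu.fderivWithin_scale hl.le c hxc (l ^ 2 * t))
    simp only [smul_apply, smul_eq_mul] at h2
    rw [h2, Real.mul_rpow hc.le (hpos _ (hmapc hxc) _).le, ← hcl, ← h1]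
    ring
  · exact mul_pos hc (hpos _ (hmapc hx) _)

end Scaling

/-- Reduction to normalized solutions: if the half-space problem has a positive
bounded classical solution, then it has a positive classical solution `v` with
`v + |∇v| ≤ 1` on the closed half-space. -/
theorem exists_normalized_halfspace_solution
    (n : ℕ) (hn : 0 < n) (q : ℝ) (hq : 1 < q)
    (hex : ∃ u : EuclideanSpace ℝ (Fin n) × ℝ → ℝ,
      IsHalfSpaceSol n hn q u ∧
      ∃ M : ℝ, ∀ x ∈ closedHalf n hn, ∀ t : ℝ, u (x, t) ≤ M) :
    ∃ v : EuclideanSpace ℝ (Fin n) × ℝ → ℝ,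
      IsHalfSpaceSol n hn q v ∧
      ∀ x ∈ closedHalf n hn, ∀ t : ℝ,
        v (x, t) + ‖fderivWithin ℝ (fun y => v (y, t)) (closedHalf n hn) x‖ ≤ 1 := by
  obtain ⟨u, hu, M, hM⟩ := hex
  obtain ⟨G, hG⟩ := hu.exists_gradient_bound hq hM
  set c : ℝ := (|M| + |G| + 1)⁻¹ with hc
  have hc0 : 0 < c := by positivity
  have hc1 : c ≤ 1 := inv_le_one_of_one_le₀ (by linarith [abs_nonneg M, abs_nonneg G])
  have hl0 : 0 < c ^ (q - 1) := Real.rpow_pos_of_pos hc0 _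
  have hl1 : c ^ (q - 1) ≤ 1 := Real.rpow_le_one hc0.le hc1 (by linarith)
  have hcl : c * c ^ (q - 1) = c ^ q := by
    rw [← Real.rpow_one_add' hc0.le (by linarith)]
    congr 1
    ring
  refine ⟨_, hu.scale hc0 hl0 hcl, fun x hx t => ?_⟩
  have hx' : c ^ (q - 1) • x ∈ closedHalf n hn := smul_mem_closedHalf hl0.le hx
  set t' : ℝ := (c ^ (q - 1)) ^ 2 * t
  change c * u (c ^ (q - 1) • x, t') + ‖fderivWithin ℝ
    (fun y => c * u (c ^ (q - 1) • y, t')) (closedHalf n hn) x‖ ≤ 1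
  rw [hu.fderivWithin_scale hl0.le c hx, norm_smul, Real.norm_eq_abs,
    abs_of_pos (mul_pos hc0 hl0)]
  calc _ ≤ c * |M| + c * 1 * |G| := by
        gcongr
        · exact (hM _ hx' _).trans (le_abs_self M)
        · exact (hG _ hx' _).trans (le_abs_self G)
    _ ≤ c * (|M| + |G| + 1) := by linarith
    _ = 1 := inv_mul_cancel₀ (by positivity)
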